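/- For t ≥ 1/2, the spectrum of the position operator x = l + l^† on the full t-free Fock space over ℂ (one mode) equals [−2√t, 2√t]; equivalently, the support of the measure with Cauchy transform G(z) = 1/(z − 1/(z − t/(z − t/⋯))) is [−2√t, 2√t]. -/

import Mathlib

open ContinuousLinearMap in
theorem aux_lower {H : Type*} [NormedAddCommGroup H] [InnerProductSpace ℂ H]
    (s : ℝ) (e : ℕ → H) (he : Orthonormal ℂ e) (X : H →L[ℂ] H)
    (hXn : ∀ n : ℕ, 2 ≤ n → X (e n) = (s : ℂ) • e (n + 1) + (s : ℂ) • e (n - 1))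
    (hs : 0 < s) (r : ℝ) (hr : r ∈ Set.Icc (-(2 * s)) (2 * s)) :
    (r : ℂ) ∈ spectrum ℂ X := by
  obtain ⟨hr1, hr2⟩ := hr
  rw [spectrum.mem_iff]
  rintro ⟨u, hu⟩
  obtain ⟨z, hz1, hz2⟩ : ∃ z : ℂ, ‖z‖ = 1 ∧ (r : ℂ) * z = s * (z ^ 2 + 1) := by
    have ha : (r / (2 * s)) ^ 2 ≤ 1 := by
      rw [div_pow, div_le_one (by positivity)]
      nlinarith
    have hb : Real.sqrt (1 - (r / (2 * s)) ^ 2) ^ 2 = 1 - (r / (2 * s)) ^ 2 :=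
      Real.sq_sqrt (by linarith)
    have hra : r = 2 * s * (r / (2 * s)) := by field_simp
    generalize Real.sqrt (1 - (r / (2 * s)) ^ 2) = b at hb
    generalize r / (2 * s) = a at *
    subst hra
    refine ⟨⟨a, b⟩, ?_, ?_⟩
    · rw [← sq_eq_sq₀ (norm_nonneg _) zero_le_one, ← Complex.normSq_eq_norm_sq, Complex.normSq_mk]
      nlinarith
    · apply Complex.ext <;> simp [pow_two]
      · linear_combination s * hb
      · ring
  let A : ℕ → H := fun k => z ^ (k + 1) • e (k + 2) - z ^ (k + 2) • e (k + 1)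
  have hA : ∀ k, ‖A k‖ ≤ 2 := fun k => by
    refine (norm_sub_le _ _).trans ?_
    rw [norm_smul, norm_smul, he.1, he.1]
    simp [hz1]; norm_num
  let v : ℕ → H := fun N => ∑ k ∈ Finset.range N, z ^ (k + 2) • e (k + 2)
  have h1 : ∀ k, (u : H →L[ℂ] H) (z ^ (k + 2) • e (k + 2)) = (s : ℂ) • (A k - A (k + 1)) := fun k => by
    rw [hu]
    simp only [ContinuousLinearMap.sub_apply, map_smul, hXn (k + 2) (by omega),
      ContinuousLinearMap.algebraMap_apply, A]
    have h3 : k + 2 - 1 = k + 1 := by omega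
    rw [h3]
    have h4 : z ^ (k + 2) * (r : ℂ) = s * z ^ (k + 3) + s * z ^ (k + 1) := by
      linear_combination z ^ (k + 1) * hz2
    have h5 : z ^ (k + 2) • (r : ℂ) • e (k + 2) = (s * z ^ (k + 3) + s * z ^ (k + 1)) • e (k + 2) := by
      rw [smul_smul, h4]
    rw [smul_sub, h5]
    module
  have h2 : ∀ N, (u : H →L[ℂ] H) (v N) = (s : ℂ) • (A 0 - A N) := fun N => by
    simp only [v, map_sum, h1]
    rw [← Finset.smul_sum, Finset.sum_range_sub']
  have h3 : ∀ N, ‖v N‖ ^ 2 = N := fun N => by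
    have he2 : Orthonormal ℂ (fun k => e (k + 2)) := he.comp (fun k => k + 2) (fun a b h => by simpa using h)
    have := he2.inner_sum (fun k => z ^ (k + 2)) (fun k => z ^ (k + 2)) (Finset.range N)
    have hzz : ∀ k : ℕ, (starRingEnd ℂ) (z ^ (k + 2)) * z ^ (k + 2) = 1 := fun k => by
      rw [← Complex.normSq_eq_conj_mul_self, Complex.normSq_eq_norm_sq]; simp [hz1]
    simp only [hzz] at this
    rw [@norm_sq_eq_re_inner ℂ]
    simp only [v, this]
    simp
  have h4 : ∀ N : ℕ, (N : ℝ) ≤ (‖(↑u⁻¹ : H →L[ℂ] H)‖ * (s * 4)) ^ 2 := fun N => by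
    rw [← h3 N]
    have e1 : v N = (↑u⁻¹ : H →L[ℂ] H) ((u : H →L[ℂ] H) (v N)) := by
      rw [← ContinuousLinearMap.mul_apply, Units.inv_mul]; simp
    gcongr
    conv_lhs => rw [e1]
    refine (ContinuousLinearMap.le_opNorm _ _).trans ?_
    gcongr
    rw [h2, norm_smul, Complex.norm_real, Real.norm_of_nonneg hs.le]
    gcongr
    refine (norm_sub_le _ _).trans ?_
    linarith [hA 0, hA N]
  obtain ⟨N, hN⟩ := exists_nat_gt ((‖(↑u⁻¹ : H →L[ℂ] H)‖ * (s * 4)) ^ 2)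
  exact absurd (h4 N) (not_le.mpr hN)

theorem aux_step {H : Type*} [NormedAddCommGroup H] [InnerProductSpace ℂ H]
    (X : H →L[ℂ] H) (hX : (X : H →ₗ[ℂ] H).IsSymmetric) (a g : ℝ) (v f : H) (c : ℂ)
    (hv : inner ℂ v f = 0) (hf : ‖f‖ = 1) (hff : inner ℂ f (X f) = 0) :
    a * ‖v + c • f‖ ^ 2 - g * (inner ℂ (v + c • f) (X (v + c • f))).re
      = (a * ‖v‖ ^ 2 - g * (inner ℂ v (X v)).re) + a * ‖c‖ ^ 2
        - 2 * g * (c * inner ℂ v (X f)).re := by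
  have h1 : ‖v + c • f‖ ^ 2 = ‖v‖ ^ 2 + ‖c‖ ^ 2 := by
    have := norm_add_sq_eq_norm_sq_add_norm_sq_of_inner_eq_zero (𝕜 := ℂ) v (c • f)
      (by rw [inner_smul_right, hv, mul_zero])
    rw [norm_smul, hf] at this
    nlinarith
  have h2 : inner ℂ f (X v) = (starRingEnd ℂ) (inner ℂ v (X f)) := by
    rw [inner_conj_symm]; exact (hX f v).symm
  rw [h1, map_add, map_smul]
  simp only [inner_add_left, inner_add_right, inner_smul_left, inner_smul_right, hff, h2]
  generalize inner ℂ v (X f) = w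
  simp
  ring

theorem aux_upper {H : Type*} [NormedAddCommGroup H] [InnerProductSpace ℂ H]
    (s : ℝ) (hs : 0 < s) (hs2 : 1 / 2 ≤ s ^ 2) (e : ℕ → H) (he : Orthonormal ℂ e)
    (hdense : (Submodule.span ℂ (Set.range e)).topologicalClosure = ⊤)
    (X : H →L[ℂ] H) (hX : (X : H →ₗ[ℂ] H).IsSymmetric)
    (hX0 : X (e 0) = e 1)
    (hX1 : X (e 1) = (s : ℂ) • e 2 + e 0)
    (hXn : ∀ n : ℕ, 2 ≤ n → X (e n) = (s : ℂ) • e (n + 1) + (s : ℂ) • e (n - 1))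
    (g : ℝ) (hg : g = 1 ∨ g = -1) (v : H) :
    0 ≤ (2 * s) * ‖v‖ ^ 2 - g * (inner ℂ v (X v)).re := by
  have hgabs : |g| = 1 := by rcases hg with rfl | rfl <;> simp
  have hgre : ∀ w : ℂ, g * w.re ≤ ‖w‖ := fun w => by
    calc g * w.re ≤ |g * w.re| := le_abs_self _
      _ = |w.re| := by rw [abs_mul, hgabs, one_mul]
      _ ≤ ‖w‖ := Complex.abs_re_le_norm w
  have hee : ∀ i j, inner ℂ (e i) (e j) = if i = j then (1 : ℂ) else 0 :=
    orthonormal_iff_ite.mp he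
  have key : ∀ (c : ℕ → ℂ) (N : ℕ),
      s * ‖c (N + 1)‖ ^ 2 ≤ (2 * s) * ‖∑ k ∈ Finset.range (N + 2), c k • e k‖ ^ 2
        - g * (inner ℂ (∑ k ∈ Finset.range (N + 2), c k • e k)
          (X (∑ k ∈ Finset.range (N + 2), c k • e k))).re := by
    intro c N
    have hin : ∀ M j : ℕ, inner ℂ (∑ k ∈ Finset.range M, c k • e k) (e j)
        = if j < M then (starRingEnd ℂ) (c j) else 0 := fun M j => by
      simp [sum_inner, inner_smul_left, hee]
    have hd : ∀ n, inner ℂ (e n) (X (e n)) = 0 := fun n => by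
      rcases n with _ | _ | n
      · simp [hX0, hee]
      · simp [hX1, hee, inner_add_right, inner_smul_right]
      · rw [hXn _ (by omega)]
        simp [hee, inner_add_right, inner_smul_right]
    induction N with
    | zero =>
      have h := aux_step X hX (2 * s) g (c 0 • e 0) (e 1) (c 1)
        (by simp [inner_smul_left, hee]) (he.1 1) (hd 1)
      have e1 : (∑ k ∈ Finset.range (0 + 2), c k • e k) = c 0 • e 0 + c 1 • e 1 := by
        simp [Finset.sum_range_succ]
      rw [e1, h]
      have h0 : inner ℂ (c 0 • e 0) (X (c 0 • e 0)) = 0 := by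
        simp [inner_smul_left, inner_smul_right, hd]
      have h1 : inner ℂ (c 0 • e 0) (X (e 1)) = (starRingEnd ℂ) (c 0) := by
        simp [hX1, inner_smul_left, inner_add_right, inner_smul_right, hee, he.1]
      rw [h0, h1, norm_smul, he.1]
      have h2 := hgre (c 1 * (starRingEnd ℂ) (c 0))
      rw [norm_mul, RCLike.norm_conj] at h2
      simp only [Complex.zero_re, mul_zero, sub_zero, mul_one, zero_add]
      have h3 : 0 ≤ 2 * s * ‖c 0‖ ^ 2 + s * ‖c 1‖ ^ 2 - 2 * (‖c 1‖ * ‖c 0‖) := by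
        have : 0 ≤ s * (2 * s * ‖c 0‖ ^ 2 + s * ‖c 1‖ ^ 2 - 2 * (‖c 1‖ * ‖c 0‖)) := by
          nlinarith [sq_nonneg (2 * s * ‖c 0‖ - ‖c 1‖), sq_nonneg (‖c 1‖)]
        exact nonneg_of_mul_nonneg_right this hs
      nlinarith
    | succ N ih =>
      have h := aux_step X hX (2 * s) g (∑ k ∈ Finset.range (N + 2), c k • e k) (e (N + 2))
        (c (N + 2)) (by simp [hin]) (he.1 _) (hd _)
      rw [show N + 1 + 2 = (N + 2) + 1 by ring, Finset.sum_range_succ, h]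
      have h1 : inner ℂ (∑ k ∈ Finset.range (N + 2), c k • e k) (X (e (N + 2)))
          = s * (starRingEnd ℂ) (c (N + 1)) := by
        rw [hXn _ (by omega), inner_add_right, inner_smul_right, inner_smul_right, hin, hin]
        simp
      rw [h1]
      have h2 := hgre (c (N + 2) * (s * (starRingEnd ℂ) (c (N + 1))))
      rw [norm_mul, norm_mul, RCLike.norm_conj, Complex.norm_real, Real.norm_of_nonneg hs.le] at h2
      rw [show N + 1 + 1 = N + 2 by ring]
      nlinarith [mul_nonneg hs.le (sq_nonneg (‖c (N + 2)‖ - ‖c (N + 1)‖))]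
  have hclosed : IsClosed {v : H | 0 ≤ (2 * s) * ‖v‖ ^ 2 - g * (inner ℂ v (X v)).re} := by
    apply isClosed_le continuous_const
    fun_prop
  have hsub : (Submodule.span ℂ (Set.range e) : Set H) ⊆
      {v : H | 0 ≤ (2 * s) * ‖v‖ ^ 2 - g * (inner ℂ v (X v)).re} := by
    intro w hw
    obtain ⟨c, rfl⟩ := (Finsupp.mem_span_range_iff_exists_finsupp).mp hw
    obtain ⟨N, hN⟩ := c.support.exists_nat_subset_range
    have e1 : (c.sum fun i a => a • e i) = ∑ k ∈ Finset.range (N + 2), c k • e k := by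
      apply Finsupp.sum_of_support_subset
      · exact hN.trans (Finset.range_mono (by omega))
      · simp
    have := key c N
    rw [← e1] at this
    exact le_trans (by positivity) this
  have := closure_minimal hsub hclosed
  rw [← Submodule.topologicalClosure_coe, hdense] at this
  exact this (Submodule.mem_top)

/-- For `t ≥ 1/2`, the spectrum of the position operator `x = l + l^†` on the one-mode
`t`-free Fock space (realized as a Hilbert space with orthonormal basis `(e_n)` on which
`x` acts as the Jacobi matrix with zero diagonal and off-diagonal entries `1, √t, √t, …`)
equals `[−2√t, 2√t]`. -/
theorem stmt17 {H : Type*} [NormedAddCommGroup H] [InnerProductSpace ℂ H] [CompleteSpace H]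
    (t : ℝ) (ht : (1 : ℝ) / 2 ≤ t) (e : ℕ → H) (he : Orthonormal ℂ e)
    (hdense : (Submodule.span ℂ (Set.range e)).topologicalClosure = ⊤)
    (X : H →L[ℂ] H) (hX : IsSelfAdjoint X)
    (hX0 : X (e 0) = e 1)
    (hX1 : X (e 1) = (Real.sqrt t : ℂ) • e 2 + e 0)
    (hXn : ∀ n : ℕ, 2 ≤ n →
      X (e n) = (Real.sqrt t : ℂ) • e (n + 1) + (Real.sqrt t : ℂ) • e (n - 1)) :
    spectrum ℂ X = (fun r : ℝ => (r : ℂ)) ''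
      Set.Icc (-(2 * Real.sqrt t)) (2 * Real.sqrt t) := by
  have hs : 0 < Real.sqrt t := Real.sqrt_pos.mpr (by linarith)
  have hs2 : 1 / 2 ≤ Real.sqrt t ^ 2 := by rw [Real.sq_sqrt (by linarith)]; exact ht
  have hsym : (X : H →ₗ[ℂ] H).IsSymmetric := ContinuousLinearMap.isSelfAdjoint_iff_isSymmetric.mp hX
  apply Set.Subset.antisymm
  · intro z hz
    have hzre : z = (z.re : ℂ) := hX.mem_spectrum_eq_re hz
    have main : ∀ g : ℝ, (g = 1 ∨ g = -1) → g * z.re ≤ 2 * Real.sqrt t := by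
      intro g hg
      have hpos : (algebraMap ℂ (H →L[ℂ] H) ((2 * Real.sqrt t : ℝ) : ℂ) - (g : ℂ) • X).IsPositive := by
        rw [ContinuousLinearMap.isPositive_def']
        refine ⟨?_, fun v => ?_⟩
        · refine IsSelfAdjoint.sub ?_ ?_
          · exact IsSelfAdjoint.algebraMap _ (by simp [isSelfAdjoint_iff])
          · exact IsSelfAdjoint.smul (by simp [isSelfAdjoint_iff]) hX
        · have := aux_upper (Real.sqrt t) hs hs2 e he hdense X hsym hX0 hX1 hXn g hg v
          rw [ContinuousLinearMap.reApplyInnerSelf_apply, inner_re_symm]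
          simp only [ContinuousLinearMap.sub_apply, ContinuousLinearMap.algebraMap_apply,
            ContinuousLinearMap.smul_apply, inner_sub_right, inner_smul_right, map_sub]
          rw [inner_self_eq_norm_sq_to_K]
          simp only [RCLike.re_to_complex, Complex.re_ofReal_mul]
          convert this using 3
          norm_cast
      have hnn : 0 ≤ algebraMap ℂ (H →L[ℂ] H) ((2 * Real.sqrt t : ℝ) : ℂ) - (g : ℂ) • X :=
        (ContinuousLinearMap.nonneg_iff_isPositive _).mpr hpos
      have hmem : ((2 * Real.sqrt t : ℝ) : ℂ) - g * z ∈ spectrum ℂ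
          (algebraMap ℂ (H →L[ℂ] H) ((2 * Real.sqrt t : ℝ) : ℂ) - (g : ℂ) • X) := by
        rw [spectrum.mem_iff] at hz ⊢
        intro h
        apply hz
        have e2 : algebraMap ℂ (H →L[ℂ] H) (((2 * Real.sqrt t : ℝ) : ℂ) - g * z) -
          (algebraMap ℂ (H →L[ℂ] H) ((2 * Real.sqrt t : ℝ) : ℂ) - (g : ℂ) • X)
            = (-g : ℂ) • (algebraMap ℂ (H →L[ℂ] H) z - X) := by
          simp only [Algebra.algebraMap_eq_smul_one]
          module
        rw [e2] at h
        rcases hg with rfl | rfl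
        · rw [← IsUnit.neg_iff]; simpa using h
        · simpa using h
      have := open scoped ComplexOrder in
        (Complex.le_def.mp (spectrum_nonneg_of_nonneg hnn hmem)).1
      simp at this
      linarith
    refine ⟨z.re, ⟨?_, ?_⟩, hzre.symm⟩
    · have := main (-1) (Or.inr rfl); linarith
    · have := main 1 (Or.inl rfl); linarith
  · rintro _ ⟨r, hr, rfl⟩
    exact aux_lower (Real.sqrt t) e he X hXn hs r hr
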